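/- Let n ≥ 2, let Ω ⊂ ℝⁿ be a bounded open convex set with B₁ ⊆ Ω ⊆ B_n (balls centered at the origin), and let v ∈ C²(Ω) ∩ C⁰(Ω̄) be a convex function with (det D²v)^{1/n} = f in Ω, v = 0 on ∂Ω, and 1 ≤ f ≤ f_max in Ω for a constant f_max. Then for every ρ with 0 < ρ < diam(Ω)/2 there exist a constant H > 0 depending only on n, f_max, ρ and a constant θ ∈ (0,1) depending only on n, f_max such that for every x ∈ Ω_ρ, every h ∈ (0, H], and every pair of points y₁ ∈ ∂S(v, h, x) and y_{1/2} ∈ ∂S(v, h/2, x) lying on the line segment from x to y₁, one has |x − y_{1/2}| ≤ θ |x − y₁|. -/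

import Mathlib

open scoped RealInnerProductSpace
noncomputable section

abbrev Euc (n : ℕ) := EuclideanSpace ℝ (Fin n)

/-- Hessian matrix of `u` at `x`. -/
def hessianMatrix {n : ℕ} (u : Euc n → ℝ) (x : Euc n) : Matrix (Fin n) (Fin n) ℝ :=
  Matrix.of fun i j =>
    iteratedFDeriv ℝ 2 u x ![EuclideanSpace.single i 1, EuclideanSpace.single j 1]

/-- Determinant of the Hessian of `u` at `x`. -/
def hessDet {n : ℕ} (u : Euc n → ℝ) (x : Euc n) : ℝ := (hessianMatrix u x).det

/-- Section of `v` at height `h` about `x`, within the domain `Ω`. -/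
def secAt {n : ℕ} (v : Euc n → ℝ) (h : ℝ) (x : Euc n) (Ω : Set (Euc n)) : Set (Euc n) :=
  {z ∈ Ω | v z < v x + ⟪gradient v x, z - x⟫ + h}

open Set MeasureTheory Filter Topology

theorem gradient_of_isLocalMin {n : ℕ} {v : Euc n → ℝ} {g z : Euc n}
    (hd : DifferentiableAt ℝ v z) (hm : IsLocalMin (fun y => v y - ⟪g, y⟫) z) :
    gradient v z = g := by
  have h1 : HasFDerivAt (fun y => v y - ⟪g, y⟫) (fderiv ℝ v z - innerSL ℝ g) z :=
    hd.hasFDerivAt.sub (innerSL ℝ g).hasFDerivAt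
  have h2 := hm.hasFDerivAt_eq_zero h1
  apply ext_inner_right ℝ
  intro y
  rw [inner_gradient_left]
  have := congrArg (fun l => l y) h2
  simp at this
  linarith

theorem grad_ineq {n : ℕ} {v : Euc n → ℝ} {Ω : Set (Euc n)} (hv : ConvexOn ℝ Ω v)
    {x z : Euc n} (hx : x ∈ Ω) (hz : z ∈ Ω) (hd : DifferentiableAt ℝ v x) :
    v x + ⟪gradient v x, z - x⟫ ≤ v z := by
  have hc : ConvexOn ℝ (AffineMap.lineMap x z ⁻¹' Ω) (v ∘ (AffineMap.lineMap x z : ℝ →ᵃ[ℝ] Euc n)) :=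
    hv.comp_affineMap _
  have hder : HasDerivAt (v ∘ (AffineMap.lineMap x z : ℝ →ᵃ[ℝ] Euc n)) (fderiv ℝ v x (z - x)) 0 := by
    have h1 : HasDerivAt (AffineMap.lineMap x z : ℝ →ᵃ[ℝ] Euc n) (z - x) 0 :=
      AffineMap.hasDerivAt_lineMap
    have h2 : HasFDerivAt v (fderiv ℝ v x) ((AffineMap.lineMap x z : ℝ →ᵃ[ℝ] Euc n) 0) := by
      simpa using hd.hasFDerivAt
    exact h2.comp_hasDerivAt (0:ℝ) h1
  have := hc.le_slope_of_hasDerivAt (x := 0) (y := 1) (by simpa) (by simpa) one_pos hder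
  simp [slope_def_field] at this
  rw [inner_gradient_left]
  simp
  linarith

theorem gradient_hasFDerivAt {n : ℕ} {v : Euc n → ℝ} {Ω : Set (Euc n)} (ho : IsOpen Ω)
    (hv : ContDiffOn ℝ 2 v Ω) {z : Euc n} (hz : z ∈ Ω) :
    HasFDerivAt (gradient v) (fderiv ℝ (gradient v) z) z ∧
      (fderiv ℝ (gradient v) z).det = hessDet v z := by
  have h1 : ContDiffAt ℝ 2 v z := hv.contDiffAt (ho.mem_nhds hz)
  have h2 : DifferentiableAt ℝ (fderiv ℝ v) z :=
    (h1.fderiv_right (m := 1) (by norm_num)).differentiableAt (by norm_num)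
  let T0 : StrongDual ℝ (Euc n) →ₗ[ℝ] Euc n :=
    { toFun := fun l => (InnerProductSpace.toDual ℝ (Euc n)).symm l
      map_add' := fun a b => by simp
      map_smul' := fun a b => by simp }
  let T : StrongDual ℝ (Euc n) →L[ℝ] Euc n := LinearMap.toContinuousLinearMap T0
  have hT : ∀ l y, ⟪T l, y⟫ = l y := fun l y => by
    change ⟪(InnerProductSpace.toDual ℝ (Euc n)).symm l, y⟫ = l y
    simp
  have h3 : HasFDerivAt (gradient v) (T ∘L (fderiv ℝ (fderiv ℝ v) z)) z :=
    T.hasFDerivAt.comp z h2.hasFDerivAt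
  refine ⟨h3.differentiableAt.hasFDerivAt, ?_⟩
  have hin : ∀ a b : Euc n, ⟪fderiv ℝ (gradient v) z a, b⟫ = fderiv ℝ (fderiv ℝ v) z a b := by
    intro a b
    rw [h3.fderiv]
    exact hT _ _
  rw [ContinuousLinearMap.det, ← LinearMap.det_toMatrix (EuclideanSpace.basisFun (Fin n) ℝ).toBasis,
    hessDet, ← Matrix.det_transpose]
  congr 1
  ext i j
  rw [Matrix.transpose_apply, LinearMap.toMatrix_apply]
  simp only [hessianMatrix, Matrix.of_apply, iteratedFDeriv_two_apply]
  simp only [Matrix.cons_val_zero, Matrix.cons_val_one]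
  rw [← hin]
  simp [EuclideanSpace.inner_single_right]

theorem gradient_injOn {n : ℕ} {v : Euc n → ℝ} {Ω : Set (Euc n)} (ho : IsOpen Ω)
    (hv : ContDiffOn ℝ 2 v Ω) (hc : ConvexOn ℝ Ω v) (hdet : ∀ z ∈ Ω, 1 ≤ hessDet v z) :
    InjOn (gradient v) Ω := by
  intro a ha b hb hab
  by_contra hne
  have hd : ∀ z ∈ Ω, DifferentiableAt ℝ v z := fun z hz =>
    (hv.contDiffAt (ho.mem_nhds hz)).differentiableAt (by norm_num)
  have h1 := grad_ineq hc ha hb (hd a ha)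
  have h2 := grad_ineq hc hb ha (hd b hb)
  rw [← hab, ← neg_sub b a, inner_neg_right] at h2
  have hg : ∀ t ∈ Ioo (0:ℝ) 1, gradient v (a + t • (b - a)) = gradient v a := by
    intro t ht
    have hmem : a + t • (b - a) ∈ Ω := hc.1.add_smul_sub_mem ha hb ⟨ht.1.le, ht.2.le⟩
    apply gradient_of_isLocalMin (hd _ hmem)
    filter_upwards [ho.mem_nhds hmem] with y hy
    have h3 := grad_ineq hc ha hy (hd a ha)
    have h4 := hc.2 ha hb (show 0 ≤ 1 - t by linarith [ht.2]) ht.1.le (by ring)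
    have h5 : (1 - t) • a + t • b = a + t • (b - a) := by module
    rw [h5] at h4
    simp only [smul_eq_mul] at h4
    rw [inner_sub_right] at h3
    rw [inner_add_right, inner_smul_right]
    have h6 : v b = v a + ⟪gradient v a, b - a⟫ := by linarith
    rw [h6] at h4
    linarith
  have hmid : a + (1/2:ℝ) • (b - a) ∈ Ω := hc.1.add_smul_sub_mem ha hb ⟨by norm_num, by norm_num⟩
  obtain ⟨hD, hdt⟩ := gradient_hasFDerivAt ho hv hmid
  have hcurve : HasDerivAt (fun t : ℝ => a + t • (b - a)) (b - a) (1/2) := by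
    simpa using ((hasDerivAt_id (1/2:ℝ)).smul_const (b - a)).const_add a
  have h6 := HasFDerivAt.comp_hasDerivAt (1/2:ℝ) hD hcurve
  have h7 : HasDerivAt (gradient v ∘ fun t : ℝ => a + t • (b - a)) 0 (1/2) := by
    apply (hasDerivAt_const (1/2:ℝ) (gradient v a)).congr_of_eventuallyEq
    filter_upwards [Ioo_mem_nhds (a := (0:ℝ)) (b := 1/2 + 1/2) (by norm_num) (by norm_num)] with t ht
    exact hg t (by norm_num at ht; exact ht)
  have h8 := h6.unique h7
  have h9 : (fderiv ℝ (gradient v) (a + (1/2:ℝ) • (b - a))).det ≠ 0 := by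
    rw [hdt]; linarith [hdet _ hmid]
  have h10 : LinearMap.ker (fderiv ℝ (gradient v) (a + (1/2:ℝ) • (b - a)) : Euc n →ₗ[ℝ] Euc n) = ⊥ := by
    by_contra hk
    exact h9 (LinearMap.det_eq_zero_iff_ker_ne_bot.mpr hk)
  have h11 := LinearMap.ker_eq_bot'.mp h10 (b - a) h8
  exact hne (sub_eq_zero.mp h11).symm

/-- Axis-parallel box in Euclidean space. -/
def eBox (n : ℕ) (a b : ℝ) : Set (Euc n) := {y | ∀ i, y i ∈ Icc a b}

theorem volume_eBox (n : ℕ) {a b : ℝ} (hab : a ≤ b) :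
    volume (eBox n a b) = ENNReal.ofReal ((b - a) ^ n) := by
  have h1 : eBox n a b = (WithLp.ofLp : Euc n → (Fin n → ℝ)) ⁻¹' (Set.pi univ fun _ => Icc a b) := by
    ext y; simp only [eBox, mem_ofPred_eq, mem_preimage, mem_univ_pi]
  rw [h1, (PiLp.volume_preserving_ofLp (Fin n)).measure_preimage]
  · rw [volume_pi_pi]
    simp [ENNReal.ofReal_pow (sub_nonneg.mpr hab)]
  · exact (MeasurableSet.univ_pi fun _ => measurableSet_Icc).nullMeasurableSet

theorem measurableSet_eBox (n : ℕ) (a b : ℝ) : MeasurableSet (eBox n a b) := by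
  have h1 : eBox n a b = (WithLp.ofLp : Euc n → (Fin n → ℝ)) ⁻¹' (Set.pi univ fun _ => Icc a b) := by
    ext y; simp only [eBox, mem_ofPred_eq, mem_preimage, mem_univ_pi]
  rw [h1]
  exact (PiLp.volume_preserving_ofLp (Fin n)).measurable
    (MeasurableSet.univ_pi fun _ => measurableSet_Icc)

/-- Aleksandrov estimate: slopes of supporting cones are attained by the gradient. -/
theorem slopes_volume_le {n : ℕ} {v : Euc n → ℝ} {Z : Set (Euc n)} (ho : IsOpen Z)
    (hbd : Bornology.IsBounded Z) (hv : ContDiffOn ℝ 2 v Z) (hcont : ContinuousOn v (closure Z))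
    {Λ : ℝ} (hdet : ∀ z ∈ Z, 1 ≤ hessDet v z ∧ hessDet v z ≤ Λ)
    {b : Euc n} {c : ℝ} (hfr : ∀ z ∈ frontier Z, v z = ⟪b, z⟫ + c)
    {q : Euc n} (hq : q ∈ Z) {G : Set (Euc n)}
    (hG : ∀ p ∈ G, ∀ z ∈ closure Z, ⟪p, z - q⟫ ≤ ⟪b, q⟫ + c - v q) :
    volume G ≤ ENNReal.ofReal Λ * volume Z := by
  have hsub : (fun p => b + p) '' G ⊆ gradient v '' Z := by
    rintro _ ⟨p, hp, rfl⟩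
    have hcomp : IsCompact (closure Z) := hbd.isCompact_closure
    obtain ⟨z, hz, hmin⟩ := hcomp.exists_isMinOn ⟨q, subset_closure hq⟩
      (f := fun z => v z - ⟪b + p, z⟫) (hcont.sub (by fun_prop))
    have key : ∃ z ∈ Z, IsMinOn (fun z => v z - ⟪b + p, z⟫) (closure Z) z := by
      by_cases hzZ : z ∈ Z
      · exact ⟨z, hzZ, hmin⟩
      · refine ⟨q, hq, ?_⟩
        have hzf : z ∈ frontier Z := ⟨hz, by rwa [ho.interior_eq]⟩
        have h1 := hfr z hzf
        have h2 := hG p hp z hz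
        intro y hy
        have h3 := hmin hy
        simp only [mem_ofPred_eq, inner_add_left, inner_sub_right] at h1 h2 h3 ⊢
        linarith
    obtain ⟨z, hzZ, hmz⟩ := key
    refine ⟨z, hzZ, ?_⟩
    apply gradient_of_isLocalMin ((hv.contDiffAt (ho.mem_nhds hzZ)).differentiableAt (by norm_num))
    filter_upwards [ho.mem_nhds hzZ] with y hy
    exact hmz (subset_closure hy)
  calc volume G = volume ((fun p => b + p) '' G) := by simp
    _ ≤ volume (gradient v '' Z) := measure_mono hsub
    _ ≤ ∫⁻ z in Z, ENNReal.ofReal |(fderiv ℝ (gradient v) z).det| ∂volume :=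
        addHaar_image_le_lintegral_abs_det_fderiv volume ho.measurableSet
          fun z hz => (gradient_hasFDerivAt ho hv hz).1.hasFDerivWithinAt
    _ ≤ ∫⁻ z in Z, ENNReal.ofReal Λ ∂volume := by
        apply setLIntegral_mono' ho.measurableSet
        intro z hz
        apply ENNReal.ofReal_le_ofReal
        rw [(gradient_hasFDerivAt ho hv hz).2, abs_of_nonneg (by linarith [(hdet z hz).1])]
        exact (hdet z hz).2
    _ = _ := by simp

/-- Lower volume estimate on a parallelepiped. -/
theorem box_det_le {n : ℕ} {v : Euc n → ℝ} {Ω : Set (Euc n)} (ho : IsOpen Ω)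
    (hv : ContDiffOn ℝ 2 v Ω) (hc : ConvexOn ℝ Ω v) (hdet : ∀ z ∈ Ω, 1 ≤ hessDet v z)
    (A : Euc n →ₗ[ℝ] Euc n) (hA : A.det ≠ 0) (z₀ : Euc n)
    (hbox : ∀ y ∈ eBox n (-2) 2, z₀ + A y ∈ Ω) {b : Euc n} {c m : ℝ} (hm : 0 ≤ m)
    (hup : ∀ y ∈ eBox n (-2) 2, v (z₀ + A y) ≤ ⟪b, z₀ + A y⟫ + c)
    (hlo : ∀ y ∈ eBox n (-1) 1, ⟪b, z₀ + A y⟫ + c - m ≤ v (z₀ + A y)) :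
    A.det ^ 2 ≤ m ^ n := by
  set S : Set (Euc n) := (fun y => z₀ + A y) '' eBox n (-1) 1 with hS
  have hsub12 : eBox n (-1) 1 ⊆ eBox n (-2) 2 := fun y hy i =>
    ⟨by linarith [(hy i).1], by linarith [(hy i).2]⟩
  have hSΩ : S ⊆ Ω := by
    rintro _ ⟨y, hy, rfl⟩; exact hbox y (hsub12 hy)
  have hSvol : volume S = ENNReal.ofReal (|A.det| * 2 ^ n) := by
    have : S = (fun y => z₀ + y) '' (A '' eBox n (-1) 1) := by rw [image_image]
    rw [this, image_add_left, measure_preimage_add, Measure.addHaar_image_linearMap,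
      volume_eBox n (by norm_num), ← ENNReal.ofReal_mul (abs_nonneg _)]
    norm_num
  have hSmeas : MeasurableSet S := by
    have hinj : Function.Injective (fun y => z₀ + A y) := by
      intro y y' h
      have h' : A y = A y' := by simpa using h
      exact (LinearMap.ker_eq_bot.mp (by
        by_contra hk
        exact hA (LinearMap.det_eq_zero_iff_ker_ne_bot.mpr hk))) h'
    have hcA : Continuous A := A.continuous_of_finiteDimensional
    exact (measurableSet_eBox n (-1) 1).image_of_continuousOn_injOn (by fun_prop) hinj.injOn
  have hd : ∀ z ∈ Ω, DifferentiableAt ℝ v z := fun z hz =>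
    (hv.contDiffAt (ho.mem_nhds hz)).differentiableAt (by norm_num)
  -- image of the gradient
  have himg : gradient v '' S ⊆ (fun p => b + p) '' ((LinearMap.adjoint A) ⁻¹' eBox n (-m) m) := by
    rintro _ ⟨_, ⟨y, hy, rfl⟩, rfl⟩
    refine ⟨gradient v (z₀ + A y) - b, ?_, by simp⟩
    have key : ∀ (i : Fin n) (s : ℝ), |s| ≤ 1 →
        s * (LinearMap.adjoint A (gradient v (z₀ + A y) - b)) i ≤ m := by
      intro i s hs
      rw [abs_le] at hs
      have hy' : y + EuclideanSpace.single i s ∈ eBox n (-2) 2 := by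
        intro j
        have := hy j
        simp only [PiLp.add_apply, PiLp.single_apply]
        split_ifs
        · constructor <;> linarith [this.1, this.2, hs.1, hs.2]
        · constructor <;> linarith [this.1, this.2]
      have h1 := grad_ineq hc (hbox y (hsub12 hy)) (hbox _ hy') (hd _ (hbox y (hsub12 hy)))
      have h2 := hup _ hy'
      have h3 := hlo y hy
      have h4 : ⟪LinearMap.adjoint A (gradient v (z₀ + A y) - b), EuclideanSpace.single i s⟫
          = s * (LinearMap.adjoint A (gradient v (z₀ + A y) - b)) i := by
        rw [EuclideanSpace.inner_single_right]; simp
      rw [← h4, LinearMap.adjoint_inner_left, inner_sub_left]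
      have h5 : z₀ + A (y + EuclideanSpace.single i s) - (z₀ + A y) = A (EuclideanSpace.single i s) := by
        rw [map_add]; abel
      rw [h5] at h1
      rw [map_add, ← add_assoc, inner_add_right] at h2
      rw [map_add, ← add_assoc] at h1
      linarith
    intro i
    have h1 := key i 1 (by norm_num)
    have h2 := key i (-1) (by norm_num)
    constructor <;> linarith
  have hAd : (LinearMap.adjoint A).det = A.det := by
    rw [← LinearMap.det_toMatrix (EuclideanSpace.basisFun (Fin n) ℝ).toBasis,
      LinearMap.toMatrix_adjoint, Matrix.det_conjTranspose, LinearMap.det_toMatrix]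
    simp
  have hle : volume S ≤ volume (gradient v '' S) := by
    have hinj := (gradient_injOn ho hv hc hdet).mono hSΩ
    rw [← lintegral_abs_det_fderiv_eq_addHaar_image volume hSmeas
      (fun z hz => (gradient_hasFDerivAt ho hv (hSΩ hz)).1.hasFDerivWithinAt) hinj]
    calc volume S = ∫⁻ z in S, 1 ∂volume := by simp
      _ ≤ _ := by
        apply setLIntegral_mono' hSmeas
        intro z hz
        rw [(gradient_hasFDerivAt ho hv (hSΩ hz)).2, ENNReal.one_le_ofReal]
        exact (hdet z (hSΩ hz)).trans (le_abs_self _)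
  have hfin : ENNReal.ofReal (|A.det| * 2 ^ n) ≤ ENNReal.ofReal (|A.det⁻¹| * (2 * m) ^ n) := by
    calc _ = volume S := hSvol.symm
      _ ≤ _ := hle.trans (measure_mono himg)
      _ = _ := by
        rw [image_add_left, measure_preimage_add,
          Measure.addHaar_preimage_linearMap _ (by rwa [hAd]), hAd,
          volume_eBox n (by linarith), ← ENNReal.ofReal_mul (abs_nonneg _)]
        congr 3; ring
  rw [ENNReal.ofReal_le_ofReal_iff (by positivity), mul_pow, abs_inv] at hfin
  have hp : 0 < |A.det| := abs_pos.mpr hA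
  have h2 : (0:ℝ) < 2 ^ n := by positivity
  have : |A.det| * |A.det| ≤ m ^ n := by
    have h3 : |A.det|⁻¹ * (2 ^ n * m ^ n) = (m ^ n / |A.det|) * 2 ^ n := by ring
    rw [h3] at hfin
    have := le_of_mul_le_mul_right hfin h2
    rwa [le_div_iff₀ hp] at this
  rwa [← sq_abs, sq]

theorem exists_normalization {n : ℕ} {K : Set (Euc n)} (hK : IsCompact K) (hconv : Convex ℝ K)
    (hint : (interior K).Nonempty) :
    ∃ (M : Matrix (Fin n) (Fin n) ℝ) (z₀ : Euc n), M.det ≠ 0 ∧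
      (∀ y : Euc n, (∀ i, 0 ≤ y i) → ∑ i, y i ≤ 1 → z₀ + M.toLpLin 2 2 y ∈ K) ∧
      ∀ z ∈ K, ∃ y ∈ eBox n (-1) 1, z = z₀ + M.toLpLin 2 2 y := by
  let mat : Euc n × (Fin n → Euc n) → Matrix (Fin n) (Fin n) ℝ :=
    fun P => Matrix.of fun k i => (P.2 i) k - P.1 k
  have hcontmat : Continuous fun P => |(mat P).det| := by
    apply Continuous.abs
    apply Continuous.matrix_det
    apply continuous_matrix
    intro k i
    simp only [mat, Matrix.of_apply]
    fun_prop
  have hcomp : IsCompact (K ×ˢ (Set.pi univ fun _ : Fin n => K)) :=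
    hK.prod (isCompact_univ_pi fun _ => hK)
  obtain ⟨c, hc⟩ := hint
  have hcK : c ∈ K := interior_subset hc
  obtain ⟨P, hP, hmax⟩ := hcomp.exists_isMaxOn ⟨(c, fun _ => c), hcK, fun _ _ => hcK⟩
    hcontmat.continuousOn
  have hdet : (mat P).det ≠ 0 := by
    obtain ⟨r, hr, hball⟩ := Metric.isOpen_iff.mp isOpen_interior c hc
    let P' : Euc n × (Fin n → Euc n) := (c, fun i => c + EuclideanSpace.single i (r / 2))
    have hP' : P' ∈ K ×ˢ (Set.pi univ fun _ : Fin n => K) := by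
      refine ⟨hcK, fun i _ => interior_subset (hball ?_)⟩
      simp [P', abs_of_pos hr, hr]
    have h1 := hmax hP'
    have h2 : mat P' = Matrix.diagonal fun _ => r / 2 := by
      ext k i
      simp [mat, P', Matrix.diagonal_apply]
    simp only [mem_ofPred_eq, h2, Matrix.det_diagonal] at h1
    intro h0
    rw [h0] at h1
    simp at h1
    have : 0 < |r / 2| ^ n := by positivity
    simp [hr.ne'] at h1
  have happ : ∀ y : Euc n, (mat P).toLpLin 2 2 y = ∑ i, y i • (P.2 i - P.1) := by
    intro y
    ext k
    simp [mat, Matrix.toLpLin_apply, Matrix.mulVec, dotProduct, mul_comm]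
  refine ⟨mat P, P.1, hdet, ?_, ?_⟩
  · intro y hy hs
    rw [happ]
    have h1 : P.1 + ∑ i, y i • (P.2 i - P.1) = (1 - ∑ i, y i) • P.1 + ∑ i, y i • P.2 i := by
      simp only [smul_sub, Finset.sum_sub_distrib, ← Finset.sum_smul]
      module
    rw [h1]
    have h2 := hconv.sum_mem (t := Finset.univ) (w := fun o : Option (Fin n) => o.elim (1 - ∑ i, y i) (fun i => y i))
      (z := fun o => o.elim P.1 P.2) (by
        rintro (_ | i) _
        · simpa using hs
        · exact hy i) (by simp [Fintype.sum_option]) (by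
        rintro (_ | i) _
        · exact hP.1
        · exact hP.2 i (mem_univ i))
    simpa [Fintype.sum_option] using h2
  · intro z hz
    let y : Euc n := WithLp.toLp 2 ((mat P)⁻¹.mulVec (z - P.1).ofLp)
    have hy : (mat P).mulVec y.ofLp = (z - P.1).ofLp := by
      simp only [y]
      rw [Matrix.mulVec_mulVec, Matrix.mul_nonsing_inv _ (isUnit_iff_ne_zero.mpr hdet),
        Matrix.one_mulVec]
    refine ⟨y, ?_, ?_⟩
    · intro i
      let P' : Euc n × (Fin n → Euc n) := (P.1, Function.update P.2 i z)
      have hP' : P' ∈ K ×ˢ (Set.pi univ fun _ : Fin n => K) := by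
        refine ⟨hP.1, fun j _ => ?_⟩
        by_cases hj : j = i
        · subst hj; simpa [P'] using hz
        · simpa [P', hj] using hP.2 j (mem_univ j)
      have h1 := hmax hP'
      have h2 : mat P' = (mat P).updateCol i (fun k => ∑ j, y j • (mat P) k j) := by
        ext k j
        by_cases hj : j = i
        · subst hj
          simp only [Matrix.updateCol_self]
          have := congrFun hy k
          simp only [Matrix.mulVec, dotProduct] at this
          simp only [smul_eq_mul]
          rw [show ∑ j, y j * mat P k j = ∑ j, mat P k j * y j from
            Finset.sum_congr rfl fun _ _ => mul_comm _ _, this]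
          simp [mat, P']
        · simp [mat, P', hj, Matrix.updateCol_ne]
      simp only [mem_ofPred_eq] at h1
      rw [h2, Matrix.det_updateCol_sum, smul_eq_mul, abs_mul] at h1
      have h3 : 0 < |(mat P).det| := abs_pos.mpr hdet
      have h4 : |y i| ≤ 1 := by
        by_contra hcon
        push Not at hcon
        nlinarith
      exact abs_le.mp h4
    · rw [Matrix.toLpLin_apply, hy]
      simp

theorem exists_polar_box {n : ℕ} (hn : 0 < n) (M : Matrix (Fin n) (Fin n) ℝ) (hM : M.det ≠ 0)
    (L : Euc n) (j : Fin n) {α d : ℝ} (hα : 0 < α) (hd : 0 < d) :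
    ∃ G : Set (Euc n),
      volume G = ENNReal.ofReal (|⟪L, M.toLpLin 2 2 (EuclideanSpace.single j 1)⟫| * (2 * n / α)
        * ((d / (4 * n)) ^ n * |M.det|⁻¹)) ∧
      ∀ p ∈ G, ∀ Δ ∈ eBox n (-2) 2, ⟪L, M.toLpLin 2 2 Δ⟫ ≤ α → ⟪p, M.toLpLin 2 2 Δ⟫ ≤ d := by
  have hn' : (0:ℝ) < n := by exact_mod_cast hn
  have hunit : IsUnit M.det := isUnit_iff_ne_zero.mpr hM
  set β : ℝ := d / (4 * n) with hβ
  have hβ0 : 0 < β := by positivity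
  let Lt : Fin n → ℝ := fun i => ⟪L, M.toLpLin 2 2 (EuclideanSpace.single i 1)⟫
  have hLt : Lt = Matrix.vecMul L.ofLp M := by
    funext i
    simp only [Lt, Matrix.toLpLin_apply, PiLp.inner_apply, Matrix.vecMul, dotProduct]
    simp [mul_comm]
  let B : Matrix (Fin n) (Fin n) ℝ := β • (M⁻¹).transpose
  let cc : Fin n → ℝ := fun i => Lt i * (2 * n / α)
  let N := B.updateCol j (fun k => ∑ i, cc i • B k i)
  have hcol : ∀ k, ∑ i, cc i • B k i = d / (2 * α) * L k := by
    intro k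
    have h1 : Matrix.vecMul Lt M⁻¹ = L.ofLp := by
      rw [hLt, Matrix.vecMul_vecMul, Matrix.mul_nonsing_inv _ hunit, Matrix.vecMul_one]
    have h2 := congrFun h1 k
    simp only [Matrix.vecMul, dotProduct] at h2
    rw [← h2, Finset.mul_sum]
    apply Finset.sum_congr rfl
    intro i _
    simp only [cc, B, Matrix.smul_apply, Matrix.transpose_apply, smul_eq_mul, hβ]
    field_simp
    ring
  have hdetN : N.det = cc j * (β ^ n * M.det⁻¹) := by
    simp only [N]
    rw [Matrix.det_updateCol_sum]
    simp only [smul_eq_mul, B, Matrix.det_smul, Matrix.det_transpose,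
      Matrix.det_nonsing_inv, Ring.inverse_eq_inv', Fintype.card_fin]
  refine ⟨N.toLpLin 2 2 '' eBox n 0 1, ?_, ?_⟩
  · rw [Measure.addHaar_image_linearMap, LinearMap.det_toLpLin, volume_eBox n zero_le_one,
      ← ENNReal.ofReal_mul (abs_nonneg _), hdetN]
    congr 1
    simp only [cc, Lt]
    rw [abs_mul, abs_mul, abs_mul, abs_inv, abs_of_pos (show 0 < 2 * n / α by positivity),
      abs_of_pos (show 0 < β ^ n by positivity)]
    ring
  · rintro _ ⟨s, hs, rfl⟩ Δ hΔ hL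
    have h1 : ⟪N.toLpLin 2 2 s, M.toLpLin 2 2 Δ⟫ =
        ∑ i, s i * ∑ k, N k i * (M.toLpLin 2 2 Δ) k := by
      simp only [PiLp.inner_apply, Matrix.toLpLin_apply 2 2 N, Matrix.mulVec, dotProduct]
      simp only [Finset.mul_sum]
      rw [Finset.sum_comm]
      apply Finset.sum_congr rfl
      intro k _
      simp only [RCLike.inner_apply, conj_trivial, Finset.mul_sum]
      apply Finset.sum_congr rfl
      intro i _
      ring
    rw [h1]
    have h2 : ∀ i, s i * ∑ k, N k i * (M.toLpLin 2 2 Δ) k ≤ 2 * β + if i = j then d / 2 else 0 := by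
      intro i
      have hs0 := (hs i).1
      have hs1 := (hs i).2
      have key : ∑ k, N k i * (M.toLpLin 2 2 Δ) k ≤ 2 * β + if i = j then d / 2 else 0 := by
        by_cases hij : i = j
        · subst hij
          simp only [if_true]
          have : ∑ k, N k i * (M.toLpLin 2 2 Δ) k = d / (2 * α) * ⟪L, M.toLpLin 2 2 Δ⟫ := by
            simp only [N, Matrix.updateCol_self, hcol, PiLp.inner_apply, RCLike.inner_apply,
              conj_trivial, Finset.mul_sum]
            apply Finset.sum_congr rfl
            intro k _
            ring
          rw [this]
          have h3 : d / (2 * α) * ⟪L, M.toLpLin 2 2 Δ⟫ ≤ d / (2 * α) * α :=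
            mul_le_mul_of_nonneg_left hL (by positivity)
          have h4 : d / (2 * α) * α = d / 2 := by field_simp
          linarith
        · simp only [hij, if_false, add_zero]
          have : ∑ k, N k i * (M.toLpLin 2 2 Δ) k = β * Δ i := by
            have h5 : (M⁻¹).mulVec (M.toLpLin 2 2 Δ).ofLp = Δ.ofLp := by
              rw [Matrix.toLpLin_apply, Matrix.mulVec_mulVec, Matrix.nonsing_inv_mul _ hunit,
                Matrix.one_mulVec]
            have h6 := congrFun h5 i
            simp only [Matrix.mulVec, dotProduct] at h6
            rw [← h6, Finset.mul_sum]
            apply Finset.sum_congr rfl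
            intro k _
            simp only [N, B]
            rw [Matrix.updateCol_ne hij]
            simp [mul_assoc]
          rw [this]
          nlinarith [(hΔ i).2]
      have hnn : 0 ≤ 2 * β + if i = j then d / 2 else 0 := by
        split_ifs <;> positivity
      nlinarith
    refine (Finset.sum_le_sum fun i _ => h2 i).trans ?_
    rw [Finset.sum_add_distrib]
    simp only [Finset.sum_const, Finset.card_univ, Fintype.card_fin, nsmul_eq_mul,
      Finset.sum_ite_eq', Finset.mem_univ, if_true]
    have : (n:ℝ) * (2 * β) = d / 2 := by rw [hβ]; field_simp; ring
    linarith

theorem key_estimate {n : ℕ} (hn : 0 < n) {v : Euc n → ℝ} {Ω : Set (Euc n)} (ho : IsOpen Ω)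
    (hv : ContDiffOn ℝ 2 v Ω) (hc : ConvexOn ℝ Ω v) {Λ : ℝ}
    (hdet : ∀ z ∈ Ω, 1 ≤ hessDet v z ∧ hessDet v z ≤ Λ)
    {Z : Set (Euc n)} (hZo : IsOpen Z) (hZc : Convex ℝ Z) (hZb : Bornology.IsBounded Z)
    (hZΩ : closure Z ⊆ Ω) {b : Euc n} {c m : ℝ} (hfr : ∀ z ∈ frontier Z, v z = ⟪b, z⟫ + c)
    (hup : ∀ z ∈ closure Z, v z ≤ ⟪b, z⟫ + c) (hlo : ∀ z ∈ closure Z, ⟪b, z⟫ + c - m ≤ v z)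
    {q : Euc n} (hq : q ∈ Z) {L : Euc n} {α W d : ℝ} (hα : 0 < α)
    (hL : ∀ z ∈ closure Z, ⟪L, z - q⟫ ≤ α) {z₁ z₂ : Euc n} (hz₁ : z₁ ∈ closure Z)
    (hz₂ : z₂ ∈ closure Z) (hW : W ≤ ⟪L, z₂ - z₁⟫) (hd : 0 < d) (hdq : d ≤ ⟪b, q⟫ + c - v q) :
    W * d ^ n ≤ (512 * (n:ℝ) ^ 3) ^ n * Λ * α * m ^ n := by
  have hn' : (0:ℝ) < n := by exact_mod_cast hn
  have hm : 0 ≤ m := by linarith [hlo q (subset_closure hq)]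
  have hΛ : 0 ≤ Λ := by linarith [(hdet q (hZΩ (subset_closure hq))).1, (hdet q (hZΩ (subset_closure hq))).2]
  obtain ⟨M, z₀, hM, hsimp, hbox⟩ := exists_normalization hZb.isCompact_closure hZc.closure
    ⟨q, interior_mono subset_closure (by rwa [hZo.interior_eq])⟩
  set A := M.toLpLin 2 2 with hA
  have hAdet : A.det = M.det := LinearMap.det_toLpLin 2 M
  have hDpos : 0 < |M.det| := abs_pos.mpr hM
  -- choice of the coordinate
  have : Nonempty (Fin n) := ⟨⟨0, hn⟩⟩
  obtain ⟨j, hj⟩ := Finite.exists_max fun i : Fin n => |⟪L, A (EuclideanSpace.single i 1)⟫|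
  have hWj : W ≤ 2 * n * |⟪L, A (EuclideanSpace.single j 1)⟫| := by
    obtain ⟨y₁, hy₁, e₁⟩ := hbox z₁ hz₁
    obtain ⟨y₂, hy₂, e₂⟩ := hbox z₂ hz₂
    have h1 : z₂ - z₁ = A (y₂ - y₁) := by rw [e₁, e₂, map_sub]; abel
    have h2 : y₂ - y₁ = ∑ i, (y₂ - y₁) i • EuclideanSpace.single i (1:ℝ) := by
      have := ((EuclideanSpace.basisFun (Fin n) ℝ).sum_repr (y₂ - y₁)).symm
      simpa using this
    rw [h1, h2, map_sum, inner_sum] at hW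
    refine hW.trans ?_
    calc ∑ i, ⟪L, A ((y₂ - y₁) i • EuclideanSpace.single i (1:ℝ))⟫
        ≤ ∑ i : Fin n, 2 * |⟪L, A (EuclideanSpace.single j 1)⟫| := by
          apply Finset.sum_le_sum
          intro i _
          rw [map_smul, inner_smul_right]
          refine (le_abs_self _).trans ?_
          rw [abs_mul]
          apply mul_le_mul _ (hj i) (abs_nonneg _) (by norm_num)
          rw [abs_le]
          simp only [PiLp.sub_apply]
          constructor <;> linarith [(hy₁ i).1, (hy₁ i).2, (hy₂ i).1, (hy₂ i).2]
      _ = _ := by simp; ring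
  -- slopes
  obtain ⟨G, hGvol, hG⟩ := exists_polar_box hn M hM L j hα hd
  rw [← hA] at hGvol
  have h1 : volume G ≤ ENNReal.ofReal Λ * volume Z := by
    apply slopes_volume_le hZo hZb (hv.mono (subset_closure.trans hZΩ))
      (hv.continuousOn.mono hZΩ) (fun z hz => hdet z (hZΩ (subset_closure hz))) hfr hq
    intro p hp z hz
    obtain ⟨y₁, hy₁, e₁⟩ := hbox q (subset_closure hq)
    obtain ⟨y₂, hy₂, e₂⟩ := hbox z hz
    have h1 : z - q = A (y₂ - y₁) := by rw [e₁, e₂, map_sub]; abel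
    refine le_trans ?_ hdq
    rw [h1]
    apply hG p hp
    · intro i
      simp only [PiLp.sub_apply]
      constructor <;> linarith [(hy₁ i).1, (hy₁ i).2, (hy₂ i).1, (hy₂ i).2]
    · rw [← h1]; exact hL z hz
  have h2 : volume Z ≤ ENNReal.ofReal (|M.det| * 2 ^ n) := by
    have hsub : Z ⊆ (fun y => z₀ + y) '' (A '' eBox n (-1) 1) := by
      intro z hz
      obtain ⟨y, hy, e⟩ := hbox z (subset_closure hz)
      exact ⟨A y, ⟨y, hy, rfl⟩, e.symm⟩
    refine (measure_mono hsub).trans ?_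
    rw [image_add_left, measure_preimage_add, Measure.addHaar_image_linearMap,
      volume_eBox n (by norm_num), ← ENNReal.ofReal_mul (abs_nonneg _), hAdet]
    norm_num
  have h3 : |⟪L, A (EuclideanSpace.single j 1)⟫| * (2 * n / α) * ((d / (4 * n)) ^ n * |M.det|⁻¹)
      ≤ Λ * (|M.det| * 2 ^ n) := by
    have := h1.trans (mul_le_mul_right h2 _)
    rw [hGvol, ← ENNReal.ofReal_mul hΛ, ENNReal.ofReal_le_ofReal_iff (by positivity)] at this
    exact this
  -- lower bound
  set r : ℝ := 1 / (8 * n) with hr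
  have hr0 : 0 < r := by positivity
  let y₀ : Euc n := WithLp.toLp 2 fun _ => 4 * r
  have hmem : ∀ y ∈ eBox n (-2) 2, z₀ + A y₀ + (r • A) y ∈ closure Z := by
    intro y hy
    have h4 : z₀ + A y₀ + (r • A) y = z₀ + A (y₀ + r • y) := by
      rw [map_add, map_smul, LinearMap.smul_apply, add_assoc]
    rw [h4]
    apply hsimp
    · intro i
      simp only [PiLp.add_apply, PiLp.smul_apply, smul_eq_mul, y₀]
      nlinarith [(hy i).1]
    · calc ∑ i, (y₀ + r • y) i ≤ ∑ i : Fin n, 6 * r := by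
            apply Finset.sum_le_sum
            intro i _
            simp only [PiLp.add_apply, PiLp.smul_apply, smul_eq_mul, y₀]
            nlinarith [(hy i).2]
        _ = n * (6 * r) := by simp
        _ ≤ 1 := by rw [hr]; field_simp; norm_num
  have hdA : (r • A).det = r ^ n * M.det := by
    rw [LinearMap.det_smul, hAdet]; simp
  have h5 := box_det_le ho hv hc (fun z hz => (hdet z hz).1) (r • A)
    (by rw [hdA]; positivity) (z₀ + A y₀) (fun y hy => hZΩ (hmem y hy)) hm
    (fun y hy => hup _ (hmem y hy)) (fun y hy => hlo _ (hmem y fun i =>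
      ⟨by linarith [(hy i).1], by linarith [(hy i).2]⟩))
  rw [hdA, mul_pow, ← sq_abs M.det] at h5
  -- conclusion
  have h6 : W * (d / (4 * n)) ^ n ≤ α * Λ * |M.det| ^ 2 * 2 ^ n := by
    have e1 : |⟪L, A (EuclideanSpace.single j 1)⟫| * (2 * n / α) * ((d / (4 * n)) ^ n * |M.det|⁻¹)
        = (2 * n * |⟪L, A (EuclideanSpace.single j 1)⟫|) * (d / (4 * n)) ^ n / (α * |M.det|) := by
      field_simp
    rw [e1, div_le_iff₀ (by positivity)] at h3
    have e2 : 0 ≤ (d / (4 * n)) ^ n := by positivity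
    nlinarith [mul_le_mul_of_nonneg_right hWj e2]
  have h7 : |M.det| ^ 2 ≤ (64 * (n:ℝ) ^ 2) ^ n * m ^ n := by
    have e3 : (r ^ n) ^ 2 * (64 * (n:ℝ) ^ 2) ^ n = 1 := by
      rw [← pow_mul, mul_comm n 2, pow_mul, ← mul_pow, hr]
      have : (1 / (8 * (n:ℝ))) ^ 2 * (64 * (n:ℝ) ^ 2) = 1 := by field_simp; norm_num
      rw [this, one_pow]
    calc |M.det| ^ 2 = (64 * (n:ℝ) ^ 2) ^ n * ((r ^ n) ^ 2 * |M.det| ^ 2) := by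
          rw [← mul_assoc, mul_comm _ ((r^n)^2), e3, one_mul]
      _ ≤ _ := mul_le_mul_of_nonneg_left h5 (by positivity)
  have e4 : W * d ^ n = (W * (d / (4 * n)) ^ n) * (4 * (n:ℝ)) ^ n := by
    rw [div_pow]; field_simp
  rw [e4]
  calc (W * (d / (4 * n)) ^ n) * (4 * (n:ℝ)) ^ n
      ≤ (α * Λ * ((64 * (n:ℝ) ^ 2) ^ n * m ^ n) * 2 ^ n) * (4 * (n:ℝ)) ^ n := by
        apply mul_le_mul_of_nonneg_right _ (by positivity)
        refine h6.trans ?_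
        gcongr
    _ = _ := by
        have : (512 * (n:ℝ) ^ 3) ^ n = (64 * (n:ℝ) ^ 2) ^ n * 2 ^ n * (4 * (n:ℝ)) ^ n := by
          rw [← mul_pow, ← mul_pow]; congr 1; ring
        rw [this]; ring

theorem sublevel_props {n : ℕ} {v : Euc n → ℝ} {Ω : Set (Euc n)} (ho : IsOpen Ω)
    (hbd : Bornology.IsBounded Ω) (hcont : ContinuousOn v (closure Ω)) (hc : ConvexOn ℝ Ω v)
    (h0 : ∀ z ∈ frontier Ω, v z = 0) {b : Euc n} {c : ℝ} (hb : ∀ z ∈ frontier Ω, ⟪b, z⟫ + c < 0)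
    {Z : Set (Euc n)} (hZ : Z = {z ∈ Ω | v z < ⟪b, z⟫ + c}) :
    IsOpen Z ∧ Convex ℝ Z ∧ Bornology.IsBounded Z ∧ closure Z ⊆ Ω ∧
      (∀ z ∈ closure Z, v z ≤ ⟪b, z⟫ + c) ∧ (∀ z ∈ frontier Z, v z = ⟪b, z⟫ + c) := by
  have hsub : Z ⊆ Ω := by rw [hZ]; exact fun z hz => hz.1
  have hcl : ∀ z ∈ closure Z, v z ≤ ⟪b, z⟫ + c := by
    intro z hz
    have : closure Z ⊆ closure Ω := closure_mono hsub
    refine closure_minimal (s := Z) (t := {z ∈ closure Ω | v z ≤ ⟪b, z⟫ + c}) ?_ ?_ hz |>.2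
    · intro z hz
      rw [hZ] at hz
      exact ⟨subset_closure hz.1, hz.2.le⟩
    · exact isClosed_closure.isClosed_le hcont (by fun_prop)
  have hopen : IsOpen Z := by
    rw [hZ]
    have h1 : ContinuousOn (fun z => v z - (⟪b, z⟫ + c)) Ω :=
      (hcont.mono subset_closure).sub (by fun_prop)
    have h2 := h1.isOpen_inter_preimage ho (isOpen_Iio (a := (0:ℝ)))
    convert h2 using 1
    ext z
    simp
  have hclΩ : closure Z ⊆ Ω := by
    intro z hz
    by_contra hcon
    have hf : z ∈ frontier Ω := ⟨closure_mono hsub hz, by rwa [ho.interior_eq]⟩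
    linarith [hcl z hz, h0 z hf, hb z hf]
  refine ⟨hopen, ?_, hbd.subset hsub, hclΩ, hcl, ?_⟩
  · rw [hZ]
    intro x hx y hy s t hs ht hst
    refine ⟨hc.1 hx.1 hy.1 hs ht hst, ?_⟩
    have h1 := hc.2 hx.1 hy.1 hs ht hst
    simp only [smul_eq_mul] at h1
    rw [inner_add_right, inner_smul_right, inner_smul_right]
    have h2 : s * v x + t * v y < s * (⟪b, x⟫ + c) + t * (⟪b, y⟫ + c) := by
      rcases hs.eq_or_lt with hs0 | hs0
      · subst hs0
        have : t = 1 := by linarith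
        subst this
        linarith [hy.2]
      · have := mul_lt_mul_of_pos_left hx.2 hs0
        have := mul_le_mul_of_nonneg_left hy.2.le ht
        linarith
    have h3 : s * (⟪b, x⟫ + c) + t * (⟪b, y⟫ + c) = s * ⟪b, x⟫ + t * ⟪b, y⟫ + c := by
      linear_combination c * hst
    linarith
  · intro z hz
    apply le_antisymm (hcl z hz.1)
    by_contra hcon
    push Not at hcon
    apply hz.2
    rw [hopen.interior_eq, hZ]
    exact ⟨hclΩ hz.1, hcon⟩

theorem grad_ineq_closure {n : ℕ} {v : Euc n → ℝ} {Ω : Set (Euc n)} (hv : ConvexOn ℝ Ω v)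
    (hcont : ContinuousOn v (closure Ω))
    {x z : Euc n} (hx : x ∈ Ω) (hz : z ∈ closure Ω) (hd : DifferentiableAt ℝ v x) :
    v x + ⟪gradient v x, z - x⟫ ≤ v z := by
  refine closure_minimal (s := Ω)
    (t := {z ∈ closure Ω | v x + ⟪gradient v x, z - x⟫ ≤ v z}) ?_ ?_ hz |>.2
  · exact fun z hz => ⟨subset_closure hz, grad_ineq hv hx hz hd⟩
  · exact isClosed_closure.isClosed_le (by fun_prop) hcont

theorem convex_closure_ineq {n : ℕ} {v : Euc n → ℝ} {Ω : Set (Euc n)} (hv : ConvexOn ℝ Ω v)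
    (hcont : ContinuousOn v (closure Ω)) {p z : Euc n} (hp : p ∈ Ω) (hz : z ∈ closure Ω)
    {t : ℝ} (ht0 : 0 ≤ t) (ht1 : t ≤ 1) :
    v ((1 - t) • p + t • z) ≤ (1 - t) * v p + t * v z := by
  refine closure_minimal (s := Ω)
    (t := {z ∈ closure Ω | v ((1 - t) • p + t • z) ≤ (1 - t) * v p + t * v z}) ?_ ?_ hz |>.2
  · intro z hz
    refine ⟨subset_closure hz, ?_⟩
    have := hv.2 hp hz (show 0 ≤ 1 - t by linarith) ht0 (by ring)
    simpa using this
  · apply isClosed_closure.isClosed_le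
    · apply hcont.comp (by fun_prop)
      intro z hz
      exact hv.1.closure (subset_closure hp) hz (show 0 ≤ 1 - t by linarith) ht0 (by ring)
    · fun_prop

theorem v_nonpos {n : ℕ} (hn : 0 < n) {v : Euc n → ℝ} {Ω : Set (Euc n)} (ho : IsOpen Ω)
    (hbd : Bornology.IsBounded Ω) (hv : ContDiffOn ℝ 2 v Ω) (hcont : ContinuousOn v (closure Ω))
    (hc : ConvexOn ℝ Ω v) (h0 : ∀ z ∈ frontier Ω, v z = 0) {x : Euc n} (hx : x ∈ Ω) :
    v x ≤ 0 := by
  have hd : DifferentiableAt ℝ v x :=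
    (hv.contDiffAt (ho.mem_nhds hx)).differentiableAt (by norm_num)
  obtain ⟨e, he, hge⟩ : ∃ e : Euc n, e ≠ 0 ∧ ∀ y, 0 ≤ ⟪e, y - x⟫ → 0 ≤ ⟪gradient v x, y - x⟫ := by
    by_cases hg : gradient v x = 0
    · refine ⟨EuclideanSpace.single ⟨0, hn⟩ 1, ?_, fun y _ => by simp [hg]⟩
      intro h
      have := congrArg norm h
      simp at this
    · exact ⟨_, hg, fun y h => h⟩
  obtain ⟨y, hy, hmax⟩ := hbd.isCompact_closure.exists_isMaxOn ⟨x, subset_closure hx⟩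
    (f := fun z => ⟪e, z⟫) (by fun_prop)
  have hyx : 0 ≤ ⟪e, y - x⟫ := by
    have := hmax (subset_closure hx)
    simp only [mem_ofPred_eq] at this
    rw [inner_sub_right]; linarith
  have hyf : y ∈ frontier Ω := by
    refine ⟨hy, ?_⟩
    rw [ho.interior_eq]
    intro hyΩ
    have hcurve : ContinuousAt (fun t : ℝ => y + t • e) 0 := by fun_prop
    have h1 : ∀ᶠ t in 𝓝 (0:ℝ), y + t • e ∈ Ω := by
      apply hcurve.eventually
      simpa using ho.mem_nhds hyΩ
    obtain ⟨ε, hε, hball⟩ := Metric.eventually_nhds_iff.mp h1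
    have h2 := hball (y := ε / 2) (by simp [abs_of_pos hε, hε])
    have h3 := hmax (subset_closure h2)
    simp only [mem_ofPred_eq, inner_add_right, inner_smul_right] at h3
    have h4 : 0 < ⟪e, e⟫ := real_inner_self_pos.mpr he
    nlinarith
  have := grad_ineq_closure hc hcont hx hy hd
  linarith [h0 y hyf, hge y hyx]

theorem norm_le_of_eBox {n : ℕ} {β : ℝ} {y : Euc n} (hy : y ∈ eBox n (-β) β) :
    ‖y‖ ≤ n * β := by
  have h2 : y = ∑ i, y i • EuclideanSpace.single i (1:ℝ) := by
    have := ((EuclideanSpace.basisFun (Fin n) ℝ).sum_repr y).symm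
    simpa using this
  rw [h2]
  refine (norm_sum_le _ _).trans ?_
  calc ∑ i, ‖y i • EuclideanSpace.single i (1:ℝ)‖ ≤ ∑ i : Fin n, β := by
        apply Finset.sum_le_sum
        intro i _
        rw [norm_smul]
        simp only [Real.norm_eq_abs, PiLp.norm_single, norm_one, mul_one]
        exact abs_le.mpr (hy i)
    _ = _ := by simp

theorem v_lower {n : ℕ} (hn : 0 < n) {v : Euc n → ℝ} {Ω : Set (Euc n)} (ho : IsOpen Ω)
    (hbd : Ω ⊆ Metric.ball 0 (n:ℝ)) (hv : ContDiffOn ℝ 2 v Ω) (hcont : ContinuousOn v (closure Ω))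
    {Λ : ℝ} (hΛ : 1 ≤ Λ) (hdet : ∀ z ∈ Ω, 1 ≤ hessDet v z ∧ hessDet v z ≤ Λ)
    (h0 : ∀ z ∈ frontier Ω, v z = 0) {q : Euc n} (hq : q ∈ Ω) :
    -(2 * (n:ℝ) ^ 3 * Λ) ≤ v q := by
  have hn' : (0:ℝ) < n := by exact_mod_cast hn
  by_contra hcon
  push Not at hcon
  set d := -v q with hd
  have hdpos : 2 * (n:ℝ) ^ 3 * Λ < d := by linarith
  have hd0 : 0 < d := lt_trans (by positivity) hdpos
  set β := d / (2 * (n:ℝ) ^ 2) with hβ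
  have hβ0 : 0 < β := by positivity
  have hbounded : Bornology.IsBounded Ω := Metric.isBounded_ball.subset hbd
  have hclb : closure Ω ⊆ Metric.closedBall 0 (n:ℝ) :=
    (closure_mono hbd).trans Metric.closure_ball_subset_closedBall
  have h1 : volume (eBox n (-β) β) ≤ ENNReal.ofReal Λ * volume Ω := by
    apply slopes_volume_le ho hbounded hv hcont hdet (b := 0) (c := 0) (q := q)
    · intro z hz; simp [h0 z hz]
    · exact hq
    · intro p hp z hz
      have e1 : ‖p‖ ≤ n * β := norm_le_of_eBox hp
      have e2 : ‖z - q‖ ≤ 2 * n := by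
        have a1 := hclb hz
        have a2 := hclb (subset_closure hq)
        rw [mem_closedBall_zero_iff] at a1 a2
        linarith [norm_sub_le z q]
      have e3 : n * β * (2 * n) = d := by rw [hβ]; field_simp
      calc ⟪p, z - q⟫ ≤ ‖p‖ * ‖z - q‖ := real_inner_le_norm _ _
        _ ≤ n * β * (2 * n) := by gcongr
        _ = d := e3
        _ = _ := by simp [hd]
  have h2 : volume Ω ≤ ENNReal.ofReal ((2 * n) ^ n) := by
    have hsub : Ω ⊆ eBox n (-n) n := by
      intro z hz i
      have a1 := hbd hz
      rw [mem_ball_zero_iff] at a1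
      have a2 := PiLp.norm_apply_le z i
      exact abs_le.mp ((by simpa using a2 : |z i| ≤ ‖z‖).trans a1.le)
    refine (measure_mono hsub).trans ?_
    rw [volume_eBox n (by linarith)]
    apply le_of_eq; congr 2; ring
  have h3 := h1.trans (mul_le_mul_right h2 _)
  rw [volume_eBox n (by linarith), ← ENNReal.ofReal_mul (by linarith),
    ENNReal.ofReal_le_ofReal_iff (by positivity)] at h3
  have h4 : (β - -β) ^ n ≤ (Λ * (2 * n)) ^ n := by
    rw [mul_pow]
    refine h3.trans ?_
    gcongr
    exact le_self_pow₀ hΛ hn.ne'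
  have h5 := le_of_pow_le_pow_left₀ hn.ne' (by positivity) h4
  have h6 : β - -β = d / (n:ℝ) ^ 2 := by rw [hβ]; field_simp; ring
  rw [h6, div_le_iff₀ (by positivity)] at h5
  nlinarith

theorem v_upper {n : ℕ} (hn : 0 < n) {v : Euc n → ℝ} {Ω : Set (Euc n)} (ho : IsOpen Ω)
    (hbd : Bornology.IsBounded Ω) (hv : ContDiffOn ℝ 2 v Ω) (hcont : ContinuousOn v (closure Ω))
    (hc : ConvexOn ℝ Ω v) (hdet : ∀ z ∈ Ω, 1 ≤ hessDet v z)
    (h0 : ∀ z ∈ frontier Ω, v z = 0) {x : Euc n} {ρ : ℝ} (hρ : 0 < ρ)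
    (hball : Metric.ball x ρ ⊆ Ω) :
    v x ≤ -((ρ / (4 * n)) ^ 2 / 4) := by
  have hn' : (0:ℝ) < n := by exact_mod_cast hn
  set r := ρ / (4 * n) with hr
  have hr0 : 0 < r := by positivity
  have hbox : ∀ y ∈ eBox n (-2) 2, x + (r • (LinearMap.id : Euc n →ₗ[ℝ] Euc n)) y ∈ Ω := by
    intro y hy
    apply hball
    have h1 : ‖y‖ ≤ n * 2 := norm_le_of_eBox hy
    simp only [LinearMap.smul_apply, LinearMap.id_apply, Metric.mem_ball, dist_self_add_left,
      norm_smul, Real.norm_eq_abs, abs_of_pos hr0]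
    have h2 : r * (n * 2) = ρ / 2 := by rw [hr]; field_simp; ring
    nlinarith
  have hdA : (r • (LinearMap.id : Euc n →ₗ[ℝ] Euc n)).det = r ^ n := by
    rw [LinearMap.det_smul]; simp
  obtain ⟨y, hy, hlt⟩ : ∃ y ∈ eBox n (-1) 1,
      v (x + (r • (LinearMap.id : Euc n →ₗ[ℝ] Euc n)) y) < -(r ^ 2 / 2) := by
    by_contra hcon
    push Not at hcon
    have h1 := box_det_le ho hv hc hdet (r • (LinearMap.id : Euc n →ₗ[ℝ] Euc n))
      (by rw [hdA]; positivity) x hbox (b := 0) (c := 0) (m := r ^ 2 / 2) (by positivity)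
      (fun y hy => by simpa using v_nonpos hn ho hbd hv hcont hc h0 (hbox y hy))
      (fun y hy => by simpa using hcon y hy)
    rw [hdA, ← pow_mul, mul_comm n 2, pow_mul] at h1
    have h2 := le_of_pow_le_pow_left₀ hn.ne' (by positivity) h1
    have : 0 < r ^ 2 := by positivity
    linarith
  have hy2 : y ∈ eBox n (-2) 2 := fun i => ⟨by linarith [(hy i).1], by linarith [(hy i).2]⟩
  have hy3 : -y ∈ eBox n (-2) 2 := fun i => by
    have := hy i
    simp only [PiLp.neg_apply]
    exact ⟨by linarith [this.2], by linarith [this.1]⟩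
  have h4 := v_nonpos hn ho hbd hv hcont hc h0 (hbox _ hy3)
  have h5 := hc.2 (hbox y hy2) (hbox _ hy3) (show (0:ℝ) ≤ 1/2 by norm_num)
    (show (0:ℝ) ≤ 1/2 by norm_num) (by norm_num)
  have h6 : (1/2:ℝ) • (x + (r • (LinearMap.id : Euc n →ₗ[ℝ] Euc n)) y) +
      (1/2:ℝ) • (x + (r • (LinearMap.id : Euc n →ₗ[ℝ] Euc n)) (-y)) = x := by
    rw [map_neg]; module
  rw [h6] at h5
  simp only [smul_eq_mul] at h5
  linarith

theorem strict_step {n : ℕ} (hn : 0 < n) {v : Euc n → ℝ} {Ω : Set (Euc n)} (ho : IsOpen Ω)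
    (hbd : Bornology.IsBounded Ω) (hv : ContDiffOn ℝ 2 v Ω) (hcont : ContinuousOn v (closure Ω))
    (hc : ConvexOn ℝ Ω v) {Λ : ℝ}
    (hdet : ∀ z ∈ Ω, 1 ≤ hessDet v z ∧ hessDet v z ≤ Λ)
    (h0 : ∀ z ∈ frontier Ω, v z = 0) {g : Euc n} {e V κ c₁ K s : ℝ}
    (hle : ∀ z ∈ closure Ω, ⟪g, z⟫ + e ≤ v z) (hV : ∀ z ∈ Ω, -V ≤ v z)
    (hκ : 0 < κ) (hV0 : 0 ≤ V) (hs : 0 < s) (hsκ : s ≤ κ / 8) (hK : K = 8 * V / κ)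
    (hc1 : 0 < c₁) (hsmall : (512 * (n : ℝ) ^ 3) ^ n * Λ * c₁ * K ^ n < 1 / 8)
    {z₀ : Euc n} (hz₀ : z₀ ∈ frontier Ω) (hz₀s : -s ≤ ⟪g, z₀⟫ + e)
    {p : Euc n} (hp : p ∈ Ω) (hps : v p - (⟪g, p⟫ + e) ≤ s) (hpκ : κ ≤ -(⟪g, p⟫ + e)) :
    ∃ p' ∈ Ω, v p' - (⟪g, p'⟫ + e) ≤ K * s ∧ (1 + c₁) * -(⟪g, p⟫ + e) ≤ -(⟪g, p'⟫ + e) := by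
  by_contra hcon
  push Not at hcon
  obtain ⟨a, ha⟩ : ∃ a, a = -(⟪g, p⟫ + e) := ⟨_, rfl⟩
  rw [← ha] at hpκ hcon
  have ha0 : 0 < a := by linarith
  obtain ⟨η, hη⟩ : ∃ η, η = 4 * s / a := ⟨_, rfl⟩
  have hηa : η * a = 4 * s := by rw [hη]; field_simp
  have hη0 : 0 < η := by rw [hη]; positivity
  have hη1 : η ≤ 1 / 2 := by rw [hη, div_le_iff₀ ha0]; linarith
  have hηK : η * (2 * V) ≤ K * s := by
    rw [hη, hK]
    have : 4 * s / a * (2 * V) = 8 * V * s / a := by ring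
    rw [this]
    have : 8 * V / κ * s = 8 * V * s / κ := by ring
    rw [this]
    exact div_le_div_of_nonneg_left (by positivity) hκ hpκ
  have hz₀l : ⟪g, z₀⟫ + e ≤ 0 := (h0 z₀ hz₀) ▸ hle z₀ hz₀.1
  have haff : ∀ z : Euc n, ⟪(1 - η) • g, z⟫ + ((1 - η) * e - 2 * s)
      = (1 - η) * (⟪g, z⟫ + e) - 2 * s := by
    intro z; rw [real_inner_smul_left]; ring
  obtain ⟨Z, hZ⟩ : ∃ Z, Z = {z ∈ Ω | v z < ⟪(1 - η) • g, z⟫ + ((1 - η) * e - 2 * s)} := ⟨_, rfl⟩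
  obtain ⟨hZo, hZc, hZb, hZΩ, hup, hfr⟩ := sublevel_props ho hbd hcont hc h0
    (b := (1 - η) • g) (c := (1 - η) * e - 2 * s) (by
      intro z hz
      rw [haff]
      have := (h0 z hz) ▸ hle z hz.1
      nlinarith) hZ
  have hbound : ∀ z ∈ closure Z, -(⟪g, z⟫ + e) ≤ 2 * V := by
    intro z hz
    have h1 := hup z hz
    rw [haff] at h1
    have h2 := hV z (hZΩ hz)
    nlinarith
  have hlow : ∀ z ∈ closure Z, -(η * (⟪g, z⟫ + e)) ≤ K * s := by
    intro z hz
    have := hbound z hz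
    nlinarith
  have hmemZ : ∀ z ∈ Ω, v z < (1 - η) * (⟪g, z⟫ + e) - 2 * s → z ∈ Z := by
    intro z hz h
    rw [hZ]
    exact ⟨hz, by rw [haff]; exact h⟩
  have hpl : ⟪g, p⟫ + e = -a := by linarith
  have hpZ : p ∈ Z := by
    apply hmemZ p hp
    rw [hpl] at hps ⊢
    linarith
  obtain ⟨t, ht⟩ : ∃ t, t = (a / 8) / (a + (⟪g, z₀⟫ + e)) := ⟨_, rfl⟩
  have hden : 0 < a + (⟪g, z₀⟫ + e) := by linarith
  have htden : t * (a + (⟪g, z₀⟫ + e)) = a / 8 := by rw [ht]; field_simp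
  have ht0 : 0 ≤ t := by rw [ht]; positivity
  have ht1 : t < 1 := by rw [ht, div_lt_one hden]; linarith
  have hz₁Ω : (1 - t) • p + t • z₀ ∈ Ω := by
    have := hc.1.combo_interior_closure_mem_interior (x := p) (y := z₀)
      (by rwa [ho.interior_eq]) hz₀.1 (a := 1 - t) (b := t) (by linarith) ht0 (by ring)
    rwa [ho.interior_eq] at this
  have hz₁v := convex_closure_ineq hc hcont hp hz₀.1 ht0 ht1.le
  have hz₁l : ⟪g, (1 - t) • p + t • z₀⟫ + e = -(7 * a / 8) := by
    rw [inner_add_right, real_inner_smul_right, real_inner_smul_right]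
    have : ⟪g, p⟫ = -a - e := by linarith
    rw [this]
    linarith
  have hz₁Z : (1 - t) • p + t • z₀ ∈ Z := by
    apply hmemZ _ hz₁Ω
    rw [hz₁l]
    rw [h0 z₀ hz₀] at hz₁v
    have h1 : v p ≤ s - a := by linarith
    have h2 : (1 - t) * v p ≤ (1 - t) * (s - a) := mul_le_mul_of_nonneg_left h1 (by linarith)
    nlinarith
  have key := key_estimate hn ho hv hc hdet hZo hZc hZb hZΩ (m := K * s) hfr hup
    (by
      intro z hz
      rw [haff]
      have h1 := hlow z hz
      have h2 := hle z (subset_closure (hZΩ hz))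
      nlinarith)
    hpZ (L := -g) (α := c₁ * a) (W := a / 8) (d := s) (by positivity)
    (by
      intro z hz
      have h1 := hup z hz
      rw [haff] at h1
      have h2 := hlow z hz
      have h3 := hcon z (hZΩ hz) (by nlinarith)
      rw [inner_neg_left, inner_sub_right]
      nlinarith)
    (subset_closure hz₁Z) (subset_closure hpZ)
    (by
      rw [inner_neg_left, inner_sub_right]
      linarith) hs
    (by rw [haff, hpl]; linarith)
  have hsn : 0 < a * s ^ n := by positivity
  have : (512 * (n : ℝ) ^ 3) ^ n * Λ * (c₁ * a) * (K * s) ^ n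
      = ((512 * (n : ℝ) ^ 3) ^ n * Λ * c₁ * K ^ n) * (a * s ^ n) := by
    rw [mul_pow]; ring
  rw [this] at key
  nlinarith

theorem ball_sub_of_infDist {n : ℕ} {Ω : Set (Euc n)}
    {x : Euc n} (hx : x ∈ Ω) {ρ : ℝ}
    (h : ρ < Metric.infDist x (frontier Ω)) : Metric.ball x ρ ⊆ Ω := by
  intro w hw
  by_contra hwΩ
  obtain ⟨y, hy, hxy⟩ := exists_mem_frontier_infDist_compl_eq_dist hx
    (fun h => hwΩ (h ▸ mem_univ w))
  have h1 := Metric.infDist_le_dist_of_mem (x := x) hy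
  have h2 := Metric.infDist_le_dist_of_mem (x := x) (show w ∈ Ωᶜ from hwΩ)
  rw [Metric.mem_ball, dist_comm] at hw
  linarith

theorem section_inside {n : ℕ} (hn : 0 < n) {Λ : ℝ} (hΛ : 1 ≤ Λ) {ρ : ℝ} (hρ : 0 < ρ) :
    ∃ H : ℝ, 0 < H ∧ ∀ (Ω : Set (Euc n)) (v : Euc n → ℝ), IsOpen Ω →
      Ω ⊆ Metric.ball 0 (n : ℝ) → ContDiffOn ℝ 2 v Ω → ContinuousOn v (closure Ω) →
      ConvexOn ℝ Ω v → (∀ z ∈ Ω, 1 ≤ hessDet v z ∧ hessDet v z ≤ Λ) →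
      (∀ z ∈ frontier Ω, v z = 0) → ∀ x ∈ Ω, Metric.ball x ρ ⊆ Ω →
      ∀ z ∈ frontier Ω, v x + ⟪gradient v x, z - x⟫ < -H := by
  obtain ⟨κ, hκd⟩ : ∃ κ, κ = (ρ / (4 * n)) ^ 2 / 4 := ⟨_, rfl⟩
  have hn' : (0 : ℝ) < n := by exact_mod_cast hn
  have hκ : 0 < κ := by rw [hκd]; positivity
  obtain ⟨V, hVd⟩ : ∃ V, V = max (2 * (n : ℝ) ^ 3 * Λ) κ := ⟨_, rfl⟩
  have hVκ : κ ≤ V := hVd ▸ le_max_right _ _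
  have hVΛ : 2 * (n : ℝ) ^ 3 * Λ ≤ V := hVd ▸ le_max_left _ _
  obtain ⟨K, hK⟩ : ∃ K, K = 8 * V / κ := ⟨_, rfl⟩
  have hK1 : 1 ≤ K := by rw [hK, le_div_iff₀ hκ]; linarith
  have hK0 : 0 < K := by linarith
  obtain ⟨c₁, hc₁⟩ : ∃ c, c = 1 / (16 * ((512 * (n : ℝ) ^ 3) ^ n * Λ * K ^ n)) := ⟨_, rfl⟩
  have hD : 0 < (512 * (n : ℝ) ^ 3) ^ n * Λ * K ^ n := by positivity
  have hc1 : 0 < c₁ := by rw [hc₁]; positivity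
  have hsmall : (512 * (n : ℝ) ^ 3) ^ n * Λ * c₁ * K ^ n < 1 / 8 := by
    have : (512 * (n : ℝ) ^ 3) ^ n * Λ * c₁ * K ^ n
      = ((512 * (n : ℝ) ^ 3) ^ n * Λ * K ^ n) * c₁ := by ring
    rw [this, hc₁]
    have : ∀ D : ℝ, 0 < D → D * (1 / (16 * D)) < 1 / 8 := by
      intro D hD
      have : D * (1 / (16 * D)) = 1 / 16 := by field_simp
      rw [this]; norm_num
    exact this _ hD
  obtain ⟨N, hN⟩ : ∃ N : ℕ, (V + 1) / κ < (1 + c₁) ^ N :=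
    pow_unbounded_of_one_lt _ (by linarith)
  rw [div_lt_iff₀ hκ] at hN
  refine ⟨min 1 (κ / 8) / K ^ N, by positivity, ?_⟩
  set H := min 1 (κ / 8) / K ^ N with hH
  have hHpos : 0 < H := by positivity
  have hHN : K ^ N * H = min 1 (κ / 8) := by rw [hH]; field_simp
  have hHk : ∀ k ≤ N, K ^ k * H ≤ min 1 (κ / 8) := by
    intro k hk
    rw [← hHN]
    exact mul_le_mul_of_nonneg_right (pow_le_pow_right₀ hK1 hk) hHpos.le
  intro Ω v ho hsub hv hcont hc hdet h0 x hx hball z₀ hz₀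
  have hbd : Bornology.IsBounded Ω := Metric.isBounded_ball.subset hsub
  by_contra hcon
  push Not at hcon
  have hdx : DifferentiableAt ℝ v x :=
    (hv.contDiffAt (ho.mem_nhds hx)).differentiableAt (by norm_num)
  obtain ⟨e, he⟩ : ∃ e, e = v x - ⟪gradient v x, x⟫ := ⟨_, rfl⟩
  have hl : ∀ z, v x + ⟪gradient v x, z - x⟫ = ⟪gradient v x, z⟫ + e := by
    intro z; rw [inner_sub_right, he]; ring
  have hle : ∀ z ∈ closure Ω, ⟪gradient v x, z⟫ + e ≤ v z := by
    intro z hz; rw [← hl]; exact grad_ineq_closure hc hcont hx hz hdx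
  have hlow : ∀ z ∈ Ω, -V ≤ v z := by
    intro z hz
    have := v_lower hn ho hsub hv hcont hΛ hdet h0 hz
    linarith
  have hxup : v x ≤ -κ := by
    rw [hκd]
    exact v_upper hn ho hbd hv hcont hc (fun z hz => (hdet z hz).1) h0 hρ hball
  rw [hl] at hcon
  have hiter : ∀ k ≤ N, ∃ p ∈ Ω, v p - (⟪gradient v x, p⟫ + e) ≤ K ^ k * H ∧
      κ * (1 + c₁) ^ k ≤ -(⟪gradient v x, p⟫ + e) := by
    intro k
    induction k with
    | zero =>
      intro _
      refine ⟨x, hx, ?_, ?_⟩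
      · rw [he]; simp only [pow_zero]; linarith
      · rw [he]; simp only [pow_zero]; linarith
    | succ k ih =>
      intro hk
      obtain ⟨p, hp, h1, h2⟩ := ih (by omega)
      have h3 := hHk k (by omega)
      have hpk : 1 ≤ K ^ k := one_le_pow₀ hK1
      have hck : 1 ≤ (1 + c₁) ^ k := one_le_pow₀ (by linarith)
      obtain ⟨p', hp', h4, h5⟩ := strict_step hn ho hbd hv hcont hc hdet h0 hle hlow hκ
        (by linarith) (s := K ^ k * H) (by positivity) (h3.trans (min_le_right _ _)) hK hc1 hsmall
        hz₀ (by nlinarith) hp h1 (by nlinarith)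
      refine ⟨p', hp', ?_, ?_⟩
      · rw [pow_succ]; linarith
      · refine le_trans ?_ h5
        rw [pow_succ]
        nlinarith
  obtain ⟨p, hp, h1, h2⟩ := hiter N le_rfl
  have h3 := (hHk N le_rfl).trans (min_le_left _ _)
  have h4 := v_nonpos hn ho hbd hv hcont hc h0 hp
  have h5 := hlow p hp
  linarith

/-- Along any ray from `x`, the boundary of the half-height section `S(v, h/2, x)` is a
definite factor `θ < 1` closer to `x` than the boundary of `S(v, h, x)`. -/
theorem half_section_ratio (n : ℕ) (hn : 2 ≤ n) (fmax : ℝ) :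
    ∃ θ : ℝ, 0 < θ ∧ θ < 1 ∧
      ∀ ρ : ℝ, 0 < ρ → ∃ H : ℝ, 0 < H ∧
        ∀ (Ω : Set (Euc n)) (v f : Euc n → ℝ),
          IsOpen Ω → Convex ℝ Ω →
          Metric.ball 0 1 ⊆ Ω → Ω ⊆ Metric.ball 0 (n : ℝ) →
          ContDiffOn ℝ 2 v Ω → ContinuousOn v (closure Ω) → ConvexOn ℝ Ω v →
          (∀ z ∈ Ω, hessDet v z = f z ^ n) →
          (∀ z ∈ frontier Ω, v z = 0) →
          (∀ z ∈ Ω, 1 ≤ f z ∧ f z ≤ fmax) →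
          ρ < Metric.diam Ω / 2 →
          ∀ x ∈ Ω, ρ < Metric.infDist x (frontier Ω) →
            ∀ h : ℝ, 0 < h → h ≤ H →
              ∀ y₁ ∈ frontier (secAt v h x Ω),
                ∀ y₂ ∈ frontier (secAt v (h / 2) x Ω),
                  y₂ ∈ segment ℝ x y₁ → ‖x - y₂‖ ≤ θ * ‖x - y₁‖ := by
  have hn0 : 0 < n := by omega
  have hn1 : (1 : ℝ) ≤ n := by exact_mod_cast hn0
  obtain ⟨Λ, hΛd⟩ : ∃ Λ, Λ = (max 1 fmax) ^ n := ⟨_, rfl⟩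
  have hΛ : 1 ≤ Λ := by rw [hΛd]; exact one_le_pow₀ (le_max_left _ _)
  obtain ⟨C, hC⟩ : ∃ C, C = (512 * (n : ℝ) ^ 3) ^ n := ⟨_, rfl⟩
  have hC1 : 1 ≤ C := by
    rw [hC]
    have : 1 ≤ (n : ℝ) ^ 3 := one_le_pow₀ hn1
    exact one_le_pow₀ (by linarith)
  have h2n : (1 : ℝ) < 2 ^ n := one_lt_pow₀ (by norm_num) (by omega)
  obtain ⟨D, hD⟩ : ∃ D, D = 2 ^ n * C * Λ := ⟨_, rfl⟩
  have hCΛ : 1 ≤ C * Λ := by nlinarith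
  have hD1 : 1 < D := by rw [hD, mul_assoc]; nlinarith
  have hD0 : 0 < D := by linarith
  refine ⟨1 - 1 / D, ?_, ?_, ?_⟩
  · have : 1 / D < 1 := by rw [div_lt_one hD0]; exact hD1
    linarith
  · have : 0 < 1 / D := by positivity
    linarith
  intro ρ hρ
  obtain ⟨H, hH, hins⟩ := section_inside hn0 hΛ hρ
  refine ⟨H, hH, ?_⟩
  intro Ω v f ho hconv _ hsub hv hcont hc hdf h0 hf _ x hx hxρ h hh hhH y₁ hy₁ y₂ hy₂ hseg
  have hbd : Bornology.IsBounded Ω := Metric.isBounded_ball.subset hsub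
  have hdet : ∀ z ∈ Ω, 1 ≤ hessDet v z ∧ hessDet v z ≤ Λ := by
    intro z hz
    obtain ⟨h1, h2⟩ := hf z hz
    rw [hdf z hz, hΛd]
    exact ⟨one_le_pow₀ h1, pow_le_pow_left₀ (by linarith) (h2.trans (le_max_right _ _)) n⟩
  have hbelow := hins Ω v ho hsub hv hcont hc hdet h0 x hx (ball_sub_of_infDist hx hxρ)
  have hdx : DifferentiableAt ℝ v x :=
    (hv.contDiffAt (ho.mem_nhds hx)).differentiableAt (by norm_num)
  have hl : ∀ k z, v x + ⟪gradient v x, z - x⟫ + k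
      = ⟪gradient v x, z⟫ + (v x - ⟪gradient v x, x⟫ + k) := by
    intro k z; rw [inner_sub_right]; ring
  have hprops : ∀ k, 0 < k → k ≤ H → _ := fun k (hk : 0 < k) (hkH : k ≤ H) =>
    sublevel_props ho hbd hcont hc h0
    (b := gradient v x) (c := v x - ⟪gradient v x, x⟫ + k) (by
      intro z hz
      rw [← hl]
      have := hbelow z hz
      linarith) (Z := secAt v k x Ω) (by simp only [secAt, hl])
  obtain ⟨hZo, hZc, hZb, hZΩ, hup, hfr⟩ := hprops h hh hhH
  obtain ⟨_, _, _, hZΩ', hup', _⟩ := hprops (h / 2) (by linarith) (by linarith)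
  have hy₂Ω : y₂ ∈ Ω := hZΩ' hy₂.1
  have hy₂u := hup' y₂ hy₂.1
  have hy₂Z : y₂ ∈ secAt v h x Ω := by
    refine ⟨hy₂Ω, ?_⟩
    rw [hl]
    linarith
  have hxZ : x ∈ secAt v h x Ω := ⟨hx, by simp [hh]⟩
  have hy₁Z : y₁ ∉ secAt v h x Ω := by
    have := hy₁.2
    rwa [hZo.interior_eq] at this
  obtain ⟨F, hF⟩ := geometric_hahn_banach_open_point hZc hZo hy₁Z
  obtain ⟨L, hL⟩ : ∃ L : Euc n, ∀ z, ⟪L, z⟫ = F z :=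
    ⟨(InnerProductSpace.toDual ℝ (Euc n)).symm F, fun z => by simp⟩
  rw [segment_eq_image'] at hseg
  obtain ⟨t, ⟨ht0, ht1⟩, rfl⟩ := hseg
  obtain ⟨W, hW⟩ : ∃ W, W = F y₁ - F x := ⟨_, rfl⟩
  have hW0 : 0 < W := by have := hF x hxZ; linarith
  have hFy₂ : F (x + t • (y₁ - x)) = F x + t * W := by
    rw [map_add, map_smul, map_sub, hW, smul_eq_mul]
  have hα : 0 < (1 - t) * W := by
    have := hF _ hy₂Z
    rw [hFy₂] at this
    linarith
  have hFcl : ∀ z ∈ closure (secAt v h x Ω), F z ≤ F y₁ := by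
    intro z hz
    refine closure_minimal (t := {z | F z ≤ F y₁}) (fun z hz => (hF z hz).le) ?_ hz
    exact isClosed_le F.continuous continuous_const
  have key := key_estimate hn0 ho hv hc hdet hZo hZc hZb hZΩ (m := h) hfr hup
    (by
      intro z hz
      rw [← hl]
      have := grad_ineq hc hx (hZΩ hz) hdx
      linarith)
    hy₂Z (L := L) (α := (1 - t) * W) (W := W) (d := h / 2) hα
    (by
      intro z hz
      rw [hL, map_sub, hFy₂]
      have := hFcl z hz
      linarith)
    (subset_closure hxZ) hy₁.1 (by rw [hL, map_sub, hW]) (by linarith) (by linarith)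
  rw [← hC, div_pow] at key
  have hhn : 0 < W * h ^ n := by positivity
  have h1D : 1 ≤ D * (1 - t) := by
    have h2 : W * (h ^ n / 2 ^ n) * 2 ^ n = W * h ^ n := by field_simp
    have h3 := mul_le_mul_of_nonneg_right key (show (0 : ℝ) ≤ 2 ^ n by positivity)
    rw [h2] at h3
    have h4 : C * Λ * ((1 - t) * W) * h ^ n * 2 ^ n = (D * (1 - t)) * (W * h ^ n) := by
      rw [hD]; ring
    rw [h4] at h3
    by_contra hcon
    push Not at hcon
    nlinarith
  have htθ : t ≤ 1 - 1 / D := by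
    have : 1 / D ≤ 1 - t := by rw [div_le_iff₀ hD0]; linarith
    linarith
  have hnorm : ‖x - (x + t • (y₁ - x))‖ = t * ‖x - y₁‖ := by
    have : x - (x + t • (y₁ - x)) = t • (x - y₁) := by module
    rw [this, norm_smul, Real.norm_of_nonneg ht0]
  rw [hnorm]
  exact mul_le_mul_of_nonneg_right htθ (norm_nonneg _)
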